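/- arXiv:1504.04966 — 2 statements merged into one kernel-verified Lean document; each statement's English description precedes it below -/
import Mathlib

section
/- If β > 1 and the generating sequence g(β) is periodic (so that n = 0 in the minimal decomposition g(β) = (g_1 ⋯ g_p)^∞ with p minimal), then every x ∈ X_β admits exactly one presentation in the Fischer graph F_β; i.e., the map sending a bi-infinite path of F_β to its label sequence is injective. -/
/-- The remainders `r_n(t)` of the β-expansion of `t` (0-indexed: `betaRem β t n = r_n(t)`). -/
noncomputable def betaRem (β t : ℝ) : ℕ → ℝ
  | 0 => t
  | n + 1 => Int.fract (β * betaRem β t n)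

/-- `betaDigit β t n` is the digit `x_{n+1}(t)` of the β-expansion of `t` (0-indexed). -/
noncomputable def betaDigit (β t : ℝ) (n : ℕ) : ℕ :=
  (⌊β * betaRem β t n⌋).toNat

/- The generating sequence `g(β)`, 0-indexed: `genSeq β i = g_{i+1}`.
If `e(β)` is eventually zero with last nonzero digit at (0-indexed) position `k`,
then `g(β)` is the periodic sequence of period `k+1` obtained from the initial word
of `e(β)` of length `k+1` by decreasing its last letter by one; otherwise `g(β) = e(β)`. -/
open scoped Classical in
noncomputable def genSeq (β : ℝ) : ℕ → ℕ :=
  if h : ∃ k, betaDigit β 1 k ≠ 0 ∧ ∀ m, k < m → betaDigit β 1 m = 0 then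
    fun i =>
      if i % (Nat.find h + 1) = Nat.find h then betaDigit β 1 (Nat.find h) - 1
      else betaDigit β 1 (i % (Nat.find h + 1))
  else
    betaDigit β 1

/-- Strict lexicographic order on one-sided sequences. -/
def lexLt (x y : ℕ → ℕ) : Prop :=
  ∃ n, (∀ i < n, x i = y i) ∧ x n < y n

/-- Lexicographic order on one-sided sequences. -/
def lexLe (x y : ℕ → ℕ) : Prop :=
  x = y ∨ lexLt x y

/-- Membership in the beta-shift `X_β` (bi-infinite sequences). -/
def memBeta (β : ℝ) (x : ℤ → ℕ) : Prop :=
  ∀ k : ℤ, lexLe (fun n : ℕ => x (k + n)) (genSeq β)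

/-- Membership in the right-ray space `X_β⁺`. -/
def rightRay (β : ℝ) (x : ℕ → ℕ) : Prop :=
  ∀ k : ℕ, lexLe (fun n : ℕ => x (k + n)) (genSeq β)

/-- The edge relation of the Fischer graph `F_β` of a sofic beta-shift whose generating
sequence is `g = g_1 g_2 ⋯` (0-indexed: `g i = g_{i+1}`) with minimal decomposition
`g(β) = g_1 ⋯ g_n (g_{n+1} ⋯ g_{n+p})^∞`.  `fischerEdge g n p a i j` says that there is
an edge labeled `a` from vertex `i` to vertex `j` (vertices are `1, …, n+p`). -/
def fischerEdge (g : ℕ → ℕ) (n p : ℕ) (a i j : ℕ) : Prop :=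
  1 ≤ i ∧ i ≤ n + p ∧
    ((a < g (i - 1) ∧ j = 1) ∨
     (a = g (i - 1) ∧ i < n + p ∧ j = i + 1) ∨
     (a = g (i - 1) ∧ i = n + p ∧ j = n + 1))

theorem betaRem_succ_eq {β t : ℝ} (hβ : 0 ≤ β) (n : ℕ) (h : 0 ≤ betaRem β t n) :
    betaRem β t (n + 1) = β * betaRem β t n - betaDigit β t n := by
  have h0 : 0 ≤ ⌊β * betaRem β t n⌋ := Int.floor_nonneg.2 (mul_nonneg hβ h)
  have h1 : ((betaDigit β t n : ℕ) : ℝ) = (⌊β * betaRem β t n⌋ : ℝ) := by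
    unfold betaDigit
    exact_mod_cast congrArg (Int.cast : ℤ → ℝ) (Int.toNat_of_nonneg h0)
  rw [h1]
  rfl

theorem betaRem_one_mem (β : ℝ) (n : ℕ) : 0 ≤ betaRem β 1 n ∧ betaRem β 1 n ≤ 1 := by
  cases n with
  | zero => simp [betaRem]
  | succ n => exact ⟨Int.fract_nonneg _, (Int.fract_lt_one _).le⟩

theorem betaRem_eq_zero_of_le {β t : ℝ} {m n : ℕ} (hmn : m ≤ n) (h : betaRem β t m = 0) :
    betaRem β t n = 0 := by
  induction n, hmn using Nat.le_induction with
  | base => exact h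
  | succ n _ ih => simp [betaRem, ih]

theorem betaDigit_eq_zero_of_le {β t : ℝ} {m n : ℕ} (hmn : m ≤ n) (h : betaRem β t m = 0) :
    betaDigit β t n = 0 := by
  simp [betaDigit, betaRem_eq_zero_of_le hmn h]

theorem betaDigit_one_zero_ne_zero {β : ℝ} (hβ : 1 < β) : betaDigit β 1 0 ≠ 0 := by
  have h : 1 ≤ ⌊β⌋ := Int.le_floor.2 (by exact_mod_cast hβ.le)
  simp only [betaDigit, betaRem, mul_one]
  omega

/-- If all digits from position `k` on vanish, then so does the remainder at position `k`. -/
theorem betaRem_one_eq_zero_of_digits {β : ℝ} (hβ : 1 < β) {k : ℕ}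
    (h : ∀ m, k ≤ m → betaDigit β 1 m = 0) : betaRem β 1 k = 0 := by
  have hpow : ∀ n, betaRem β 1 (k + n) = β ^ n * betaRem β 1 k := by
    intro n
    induction n with
    | zero => simp
    | succ n ih =>
      rw [← add_assoc, betaRem_succ_eq (by linarith) _ (betaRem_one_mem β _).1,
        h _ (Nat.le_add_right k n), ih]
      push_cast
      ring
  by_contra hne
  have hpos : 0 < betaRem β 1 k := lt_of_le_of_ne (betaRem_one_mem β k).1 (Ne.symm hne)
  obtain ⟨n, hn⟩ := pow_unbounded_of_one_lt (1 / betaRem β 1 k) hβ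
  rw [div_lt_iff₀ hpos, ← hpow] at hn
  linarith [(betaRem_one_mem β (k + n)).2]

/-- The generating sequence is the digit sequence of the quasi-greedy expansion of `1`, whose
remainders lie in `(0, 1]`. -/
theorem exists_genSeq_remainders {β : ℝ} (hβ : 1 < β) :
    ∃ r : ℕ → ℝ, r 0 = 1 ∧ (∀ n, 0 < r n ∧ r n ≤ 1) ∧
      ∀ n, r (n + 1) = β * r n - genSeq β n := by
  classical
  have hβ0 : (0 : ℝ) ≤ β := by linarith
  by_cases h : ∃ k, betaDigit β 1 k ≠ 0 ∧ ∀ m, k < m → betaDigit β 1 m = 0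
  · obtain ⟨K, hK⟩ : ∃ K, K = Nat.find h := ⟨_, rfl⟩
    have hspec : betaDigit β 1 K ≠ 0 ∧ ∀ m, K < m → betaDigit β 1 m = 0 :=
      hK ▸ Nat.find_spec h
    have hg : genSeq β = fun i => if i % (K + 1) = K then betaDigit β 1 K - 1
        else betaDigit β 1 (i % (K + 1)) := by
      unfold genSeq
      rw [dif_pos h, hK]
    refine ⟨fun n => betaRem β 1 (n % (K + 1)), by simp [betaRem], fun n => ?_, fun n => ?_⟩
    · refine ⟨lt_of_le_of_ne (betaRem_one_mem β _).1 fun h0 => hspec.1 ?_,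
        (betaRem_one_mem β _).2⟩
      exact betaDigit_eq_zero_of_le (Nat.lt_succ_iff.1 (Nat.mod_lt n K.succ_pos)) h0.symm
    · have hstep := betaRem_succ_eq hβ0 (n % (K + 1)) (betaRem_one_mem β _).1
      have hlt : n % (K + 1) < K + 1 := Nat.mod_lt n K.succ_pos
      rw [hg]
      dsimp only
      by_cases hn : n % (K + 1) = K
      · have h1 : (n + 1) % (K + 1) = 0 := by
          rw [Nat.add_mod, hn]
          rcases K with _ | K
          · simp
          · rw [Nat.mod_eq_of_lt (show 1 < K + 1 + 1 by omega), Nat.mod_self]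
        have h2 : betaRem β 1 (K + 1) = 0 :=
          betaRem_one_eq_zero_of_digits hβ fun m hm => hspec.2 m hm
        rw [if_pos hn, h1, hn, Nat.cast_sub (Nat.one_le_iff_ne_zero.2 hspec.1)]
        rw [hn, h2] at hstep
        simp only [betaRem, Nat.cast_one]
        linarith
      · have h1 : (n + 1) % (K + 1) = n % (K + 1) + 1 := by
          rw [← Nat.mod_add_mod, Nat.mod_eq_of_lt]
          omega
        rw [if_neg hn, h1, hstep]
  · have hg : genSeq β = betaDigit β 1 := by
      unfold genSeq
      rw [dif_neg h]
    refine ⟨betaRem β 1, rfl, fun n => ⟨lt_of_le_of_ne (betaRem_one_mem β n).1 fun h0 => h ?_,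
      (betaRem_one_mem β n).2⟩, fun n => ?_⟩
    · have hz : ∀ m, n ≤ m → betaDigit β 1 m = 0 :=
        fun m hm => betaDigit_eq_zero_of_le hm h0.symm
      refine ⟨Nat.findGreatest (fun k => betaDigit β 1 k ≠ 0) n, ?_, fun m hm => ?_⟩
      · exact Nat.findGreatest_spec (P := fun k => betaDigit β 1 k ≠ 0) (Nat.zero_le n)
          (betaDigit_one_zero_ne_zero hβ)
      · rcases le_total n m with hnm | hnm
        · exact hz m hnm
        · exact not_not.1 (Nat.findGreatest_is_greatest hm hnm)
    · rw [hg]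
      exact betaRem_succ_eq hβ0 n (betaRem_one_mem β n).1

/-- Every shift of the generating sequence is lexicographically at most the sequence itself. -/
theorem genSeq_shift_le {β : ℝ} (hβ : 1 < β) (k n : ℕ)
    (h : ∀ m < n, genSeq β (k + m) = genSeq β m) : genSeq β (k + n) ≤ genSeq β n := by
  obtain ⟨r, h0, hr, hs⟩ := exists_genSeq_remainders hβ
  have hle : ∀ m ≤ n, r (k + m) ≤ r m := by
    intro m
    induction m with
    | zero => intro _; rw [h0]; exact (hr _).2
    | succ m ih =>
      intro hm
      rw [← add_assoc, hs, hs, h m hm]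
      have := mul_le_mul_of_nonneg_left (ih (by omega)) (show (0 : ℝ) ≤ β by linarith)
      linarith
  by_contra! hlt
  have h1 : (genSeq β n : ℝ) + 1 ≤ genSeq β (k + n) := by exact_mod_cast hlt
  have h2 := mul_le_mul_of_nonneg_left (hle n le_rfl) (show (0 : ℝ) ≤ β by linarith)
  have h3 := hs n
  have h4 := hs (k + n)
  linarith [(hr (n + 1)).2, (hr (k + n + 1)).1]

/-- The `a` letters of `x` preceding position `i` form the prefix of length `a` of `g`. -/
def MatchesPrefix (g : ℕ → ℕ) (x : ℤ → ℕ) (i : ℤ) (a : ℕ) : Prop :=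
  ∀ m < a, x (i - a + m) = g m

section MatchesPrefix

variable {g : ℕ → ℕ} {x : ℤ → ℕ} {i : ℤ} {a b p : ℕ}

theorem matchesPrefix_zero : MatchesPrefix g x i 0 := fun m hm => absurd hm (Nat.not_lt_zero m)

theorem matchesPrefix_succ :
    MatchesPrefix g x (i + 1) (a + 1) ↔ MatchesPrefix g x i a ∧ x i = g a := by
  have e : ∀ m : ℕ, i + 1 - ((a + 1 : ℕ) : ℤ) + m = i - a + m := fun m => by push_cast; ring
  have e' : i - a + (a : ℤ) = i := by ring
  constructor
  · intro h
    refine ⟨fun m hm => by rw [← h m (by omega), e], ?_⟩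
    rw [← h a (by omega), e, e']
  · rintro ⟨h, h'⟩ m hm
    rw [e]
    rcases Nat.lt_succ_iff_lt_or_eq.1 hm with hm | rfl
    · exact h m hm
    · rw [e', h']

theorem MatchesPrefix.overlap (ha : MatchesPrefix g x i a) (hb : MatchesPrefix g x i b)
    (hba : b ≤ a) : ∀ m < b, g (a - b + m) = g m := by
  intro m hm
  rw [← ha (a - b + m) (by omega), ← hb m hm]
  congr 1
  push_cast [Nat.cast_sub hba]
  ring

theorem MatchesPrefix.next_le
    (hadm : ∀ k n, (∀ m < n, g (k + m) = g m) → g (k + n) ≤ g n)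
    (ha : MatchesPrefix g x i a) (hb : MatchesPrefix g x i b) (hba : b ≤ a) : g a ≤ g b := by
  have h := hadm (a - b) b (ha.overlap hb hba)
  rwa [Nat.sub_add_cancel hba] at h

/-- The period word of a shift-maximal sequence is unbordered. -/
theorem MatchesPrefix.not_of_lt_period
    (hadm : ∀ k n, (∀ m < n, g (k + m) = g m) → g (k + n) ≤ g n)
    (hper : ∀ k, g (k + p) = g k)
    (hmin : ∀ q : ℕ, 1 ≤ q → (∀ k, g (k + q) = g k) → p ≤ q)
    (hp : MatchesPrefix g x i p) (hb0 : 1 ≤ b) (hbp : b < p) : ¬ MatchesPrefix g x i b := by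
  intro hb
  have hov := hp.overlap hb hbp.le
  have hshift : ∀ m, g (b + m) = g m := by
    intro m
    induction m using Nat.strong_induction_on with
    | _ m ih =>
      refine le_antisymm (hadm b m ih) ?_
      have h := hadm (p - b) (b + m) fun j hj => by
        rcases lt_or_ge j b with hjb | hjb
        · exact hov j hjb
        · obtain ⟨t, rfl⟩ := Nat.exists_eq_add_of_le hjb
          rw [ih t (by omega), ← hper t]
          congr 1
          omega
      rwa [show p - b + (b + m) = m + p by omega, hper] at h
  have := hmin b hb0 fun k => by rw [add_comm, hshift]
  omega

theorem MatchesPrefix.letter_le (hx : ∀ k : ℤ, lexLe (fun n : ℕ => x (k + n)) g)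
    (ha : MatchesPrefix g x i a) : x i ≤ g a := by
  have e : i - a + (a : ℤ) = i := by ring
  rcases hx (i - a) with h | ⟨n, h, hn⟩
  · have := congrFun h a
    simp only [e] at this
    exact this.le
  · rcases lt_trichotomy n a with hna | rfl | hna
    · exact absurd (ha n hna) hn.ne
    · simp only [e] at hn
      exact hn.le
    · have := h a hna
      simp only [e] at this
      exact this.le

end MatchesPrefix

/-- A vertex of a presentation in a Fischer graph with `n = 0` records a prefix of `g` that has
just been read. -/
theorem matchesPrefix_of_presentation {g : ℕ → ℕ} {p : ℕ} {x v : ℤ → ℕ}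
    (hv : ∀ i : ℤ, fischerEdge g 0 p (x i) (v i) (v (i + 1))) (i : ℤ) :
    MatchesPrefix g x i (v i - 1) := by
  obtain ⟨a, ha⟩ : ∃ a, a = v i - 1 := ⟨_, rfl⟩
  rw [← ha]
  induction a generalizing i with
  | zero => exact matchesPrefix_zero
  | succ a ih =>
    obtain ⟨j, rfl⟩ : ∃ j, i = j + 1 := ⟨i - 1, by ring⟩
    obtain ⟨h1, -, h | h | h⟩ := hv j
    · omega
    · have hja : a = v j - 1 := by omega
      exact matchesPrefix_succ.2 ⟨ih j hja, hja ▸ h.1⟩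
    · omega

/-- A vertex of a presentation records the longest prefix of `g`, of length less than the
period, that has just been read. -/
theorem MatchesPrefix.lt_of_presentation {g : ℕ → ℕ} {p : ℕ} {x v : ℤ → ℕ}
    (hadm : ∀ k n, (∀ m < n, g (k + m) = g m) → g (k + n) ≤ g n)
    (hper : ∀ k, g (k + p) = g k)
    (hmin : ∀ q : ℕ, 1 ≤ q → (∀ k, g (k + q) = g k) → p ≤ q)
    (hv : ∀ i : ℤ, fischerEdge g 0 p (x i) (v i) (v (i + 1))) {i : ℤ} {c : ℕ} (hc : c < p)
    (h : MatchesPrefix g x i c) : c < v i := by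
  induction c generalizing i with
  | zero => exact (hv i).1
  | succ c ih =>
    obtain ⟨j, rfl⟩ : ∃ j, i = j + 1 := ⟨i - 1, by ring⟩
    obtain ⟨hm, hxj⟩ := matchesPrefix_succ.1 h
    have hlt := ih (by omega) hm
    have hvm := matchesPrefix_of_presentation hv j
    have hle := hvm.next_le hadm hm (by omega)
    obtain ⟨h1, -, h' | h' | h'⟩ := hv j
    · omega
    · omega
    · have hp : MatchesPrefix g x (j + 1) (v j - 1 + 1) := matchesPrefix_succ.2 ⟨hvm, h'.1⟩
      rw [show v j - 1 + 1 = p by omega] at hp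
      exact absurd h (hp.not_of_lt_period hadm hper hmin (by omega) hc)

/-- The vertices recording the longest prefix of `g`, of length less than the period, that has
just been read form a presentation. -/
theorem exists_presentation {g : ℕ → ℕ} {p : ℕ} {x : ℤ → ℕ} (hp : 1 ≤ p)
    (hadm : ∀ k n, (∀ m < n, g (k + m) = g m) → g (k + n) ≤ g n)
    (hper : ∀ k, g (k + p) = g k)
    (hmin : ∀ q : ℕ, 1 ≤ q → (∀ k, g (k + q) = g k) → p ≤ q)
    (hx : ∀ k : ℤ, lexLe (fun n : ℕ => x (k + n)) g) :
    ∃ v : ℤ → ℕ, ∀ i : ℤ, fischerEdge g 0 p (x i) (v i) (v (i + 1)) := by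
  classical
  have hlong : ∀ i, ∃ a < p, MatchesPrefix g x i a ∧
      ∀ b < p, MatchesPrefix g x i b → b ≤ a := fun i =>
    ⟨Nat.findGreatest (MatchesPrefix g x i) (p - 1),
      lt_of_le_of_lt (Nat.findGreatest_le _) (by omega),
      Nat.findGreatest_spec (Nat.zero_le _) matchesPrefix_zero,
      fun b hb h => Nat.le_findGreatest (by omega) h⟩
  choose u hup hum hmax using hlong
  refine ⟨fun i => u i + 1, fun i => ⟨Nat.le_add_left 1 (u i), by simpa using hup i, ?_⟩⟩
  simp only [Nat.add_sub_cancel, zero_add]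
  have hup' := hup i
  rcases (hum i).letter_le hx |>.lt_or_eq with hlt | heq
  · refine Or.inl ⟨hlt, ?_⟩
    obtain ⟨c, hc⟩ : ∃ c, c = u (i + 1) := ⟨_, rfl⟩
    have hm := hum (i + 1)
    have hcp := hup (i + 1)
    rw [← hc] at hm hcp ⊢
    cases c with
    | zero => rfl
    | succ c =>
      obtain ⟨hm, hxc⟩ := matchesPrefix_succ.1 hm
      have := (hum i).next_le hadm hm (hmax i c (by omega) hm)
      omega
  · have hm : MatchesPrefix g x (i + 1) (u i + 1) := matchesPrefix_succ.2 ⟨hum i, heq⟩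
    rcases Nat.lt_or_ge (u i + 1) p with hlt | hge
    · refine Or.inr (Or.inl ⟨heq, hlt, ?_⟩)
      have h1 := hmax (i + 1) _ hlt hm
      obtain ⟨c, hc⟩ : ∃ c, u (i + 1) = c + 1 := ⟨u (i + 1) - 1, by omega⟩
      have h2 := hum (i + 1)
      have hcp := hup (i + 1)
      rw [hc] at h2 hcp
      have := hmax i c (by omega) (matchesPrefix_succ.1 h2).1
      omega
    · have hpe : u i + 1 = p := by omega
      refine Or.inr (Or.inr ⟨heq, hpe, ?_⟩)
      rw [hpe] at hm
      by_contra hne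
      exact hm.not_of_lt_period hadm hper hmin (by omega) (hup (i + 1)) (hum (i + 1))

/-- if `g(β)` is periodic with minimal period `p` (so `n = 0`), then every
`x ∈ X_β` admits exactly one presentation in the Fischer graph `F_β`; i.e. the labeling map
on bi-infinite paths of `F_β` is injective. -/
theorem statement8 (β : ℝ) (hβ : 1 < β) (p : ℕ) (hp : 1 ≤ p)
    (hper : ∀ k, genSeq β (k + p) = genSeq β k)
    (hmin : ∀ q : ℕ, 1 ≤ q → (∀ k, genSeq β (k + q) = genSeq β k) → p ≤ q)
    (x : ℤ → ℕ) (hx : memBeta β x) :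
    ∃! v : ℤ → ℕ, ∀ i : ℤ, fischerEdge (genSeq β) 0 p (x i) (v i) (v (i + 1)) := by
  have hadm := genSeq_shift_le hβ
  obtain ⟨v, hv⟩ := exists_presentation hp hadm hper hmin hx
  refine ⟨v, hv, fun w hw => funext fun i => ?_⟩
  have h1 := (matchesPrefix_of_presentation hv i).lt_of_presentation hadm hper hmin hw
    (by have := hv i; unfold fischerEdge at this; omega)
  have h2 := (matchesPrefix_of_presentation hw i).lt_of_presentation hadm hper hmin hv
    (by have := hw i; unfold fischerEdge at this; omega)
  omega
end

section
/- Krieger cover equals Fischer cover, cardinality form: let β > 1 have eventually periodic generating sequence g(β), with n ≥ 0 and p ≥ 1 minimal such that g(β) = g_1 ⋯ g_n (g_{n+1} ⋯ g_{n+p})^∞. Then the collection of predecessor sets { P^∞(x^+) : x^+ ∈ X_β^+ } has exactly n + p elements. -/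
/-- The bi-infinite sequence `z` with `z_{−1−n} = y n` and `z_n = x n` for `n ≥ 0`. -/
def combine (y x : ℕ → ℕ) : ℤ → ℕ :=
  fun i : ℤ => if 0 ≤ i then x i.toNat else y (-(i + 1)).toNat

/-- The predecessor set `P^∞(x⁺)` of a right-ray. -/
def predSet (β : ℝ) (x : ℕ → ℕ) : Set (ℕ → ℕ) :=
  { y | memBeta β (combine y x) }

theorem lexLt_iff_toLex_lt (x y : ℕ → ℕ) : lexLt x y ↔ toLex x < toLex y := Iff.rfl

theorem lexLe_iff_toLex_le (x y : ℕ → ℕ) : lexLe x y ↔ toLex x ≤ toLex y := by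
  rw [le_iff_eq_or_lt, lexLe, lexLt_iff_toLex_lt]
  exact or_congr_left toLex_inj.symm

theorem lexLe_refl (x : ℕ → ℕ) : lexLe x x := Or.inl rfl

theorem lexLe_trans {x y z : ℕ → ℕ} (h₁ : lexLe x y) (h₂ : lexLe y z) : lexLe x z := by
  rw [lexLe_iff_toLex_le] at *
  exact h₁.trans h₂

theorem lexLe_total (x y : ℕ → ℕ) : lexLe x y ∨ lexLe y x := by
  simp only [lexLe_iff_toLex_le]
  exact le_total _ _

theorem lexLe_antisymm {x y : ℕ → ℕ} (h₁ : lexLe x y) (h₂ : lexLe y x) : x = y := by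
  rw [lexLe_iff_toLex_le] at *
  exact toLex_inj.1 (le_antisymm h₁ h₂)

/-- Lexicographic comparison splits into a comparison of the prefixes of length `m` and, if these
agree, of the remaining tails. -/
theorem lexLe_iff_prefix (m : ℕ) (u g : ℕ → ℕ) :
    lexLe u g ↔ (∃ d < m, (∀ i < d, u i = g i) ∧ u d < g d) ∨
      ((∀ i < m, u i = g i) ∧ lexLe (fun t => u (m + t)) (fun t => g (m + t))) := by
  constructor
  · rintro (rfl | ⟨d, hd, hlt⟩)
    · exact Or.inr ⟨fun _ _ => rfl, lexLe_refl _⟩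
    · by_cases h : d < m
      · exact Or.inl ⟨d, h, hd, hlt⟩
      · refine Or.inr ⟨fun i hi => hd i (by omega), Or.inr ⟨d - m, fun i hi => hd _ (by omega), ?_⟩⟩
        have : m + (d - m) = d := by omega
        simpa only [this] using hlt
  · rintro (⟨d, -, hd, hlt⟩ | ⟨hpre, htail | ⟨d, hd, hlt⟩⟩)
    · exact Or.inr ⟨d, hd, hlt⟩
    · left
      funext i
      by_cases h : i < m
      · exact hpre i h
      · have := congrFun htail (i - m)
        have e : m + (i - m) = i := by omega
        simpa only [e] using this
    · refine Or.inr ⟨m + d, fun i hi => ?_, hlt⟩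
      by_cases h : i < m
      · exact hpre i h
      · have := hd (i - m) (by omega)
        have e : m + (i - m) = i := by omega
        simpa only [e] using this

theorem betaRem_nonneg (β : ℝ) {t : ℝ} (ht : 0 ≤ t) (n : ℕ) : 0 ≤ betaRem β t n := by
  cases n with
  | zero => exact ht
  | succ n => exact Int.fract_nonneg _

theorem betaRem_one_le_one (β : ℝ) (n : ℕ) : betaRem β 1 n ≤ 1 := by
  cases n with
  | zero => exact le_rfl
  | succ n => exact (Int.fract_lt_one _).le

theorem betaRem_add (β t : ℝ) (k n : ℕ) :
    betaRem β t (k + n) = betaRem β (betaRem β t k) n := by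
  induction n with
  | zero => rfl
  | succ n ih => rw [← add_assoc, betaRem, ih, betaRem]

theorem betaDigit_add (β t : ℝ) (k n : ℕ) :
    betaDigit β t (k + n) = betaDigit β (betaRem β t k) n := by
  rw [betaDigit, betaDigit, betaRem_add]

theorem betaRem_succ_eq_sub_betaDigit {β t : ℝ} (hβ : 0 ≤ β) (ht : 0 ≤ t) (n : ℕ) :
    betaRem β t (n + 1) = β * betaRem β t n - betaDigit β t n := by
  have h : 0 ≤ ⌊β * betaRem β t n⌋ :=
    Int.floor_nonneg.2 (mul_nonneg hβ (betaRem_nonneg β ht n))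
  have h' : ((betaDigit β t n : ℕ) : ℝ) = (⌊β * betaRem β t n⌋ : ℝ) := by
    rw [betaDigit]
    exact_mod_cast congrArg (Int.cast (R := ℝ)) (Int.toNat_of_nonneg h)
  rw [h', betaRem, Int.fract]

/-- The β-expansion is monotone for the lexicographic order. -/
theorem lexLe_betaDigit_of_le {β r s : ℝ} (hβ : 0 ≤ β) (hr : 0 ≤ r) (hrs : r ≤ s) :
    lexLe (betaDigit β r) (betaDigit β s) := by
  classical
  by_cases h : ∃ d, betaDigit β r d ≠ betaDigit β s d
  · have hpre : ∀ i < Nat.find h, betaDigit β r i = betaDigit β s i := fun i hi => by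
      simpa using Nat.find_min h hi
    have hrem : ∀ i ≤ Nat.find h, betaRem β r i ≤ betaRem β s i := by
      intro i
      induction i with
      | zero => exact fun _ => hrs
      | succ i ih =>
        intro hi
        rw [betaRem_succ_eq_sub_betaDigit hβ hr, betaRem_succ_eq_sub_betaDigit hβ (hr.trans hrs),
          hpre i (by omega)]
        have := mul_le_mul_of_nonneg_left (ih (by omega)) hβ
        linarith
    refine Or.inr ⟨Nat.find h, hpre, lt_of_le_of_ne ?_ (Nat.find_spec h)⟩
    exact Int.toNat_le_toNat (Int.floor_mono (mul_le_mul_of_nonneg_left (hrem _ le_rfl) hβ))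
  · left
    funext d
    by_contra hd
    exact h ⟨d, hd⟩

theorem lexLe_betaDigit_one_shift {β : ℝ} (hβ : 0 ≤ β) (k : ℕ) :
    lexLe (fun t => betaDigit β 1 (k + t)) (betaDigit β 1) := by
  simp only [betaDigit_add]
  exact lexLe_betaDigit_of_le hβ (betaRem_nonneg β zero_le_one k) (betaRem_one_le_one β k)

/-- The sequence `(a_0 ⋯ a_{K-1} (a_K - 1))^∞` is shift-maximal if `a` is and `a_K ≠ 0`. -/
theorem lexLe_shift_of_periodic {a g : ℕ → ℕ} {K : ℕ} (hK : a K ≠ 0)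
    (ha : ∀ k, lexLe (fun t => a (k + t)) a)
    (hg : ∀ i, g i = if i % (K + 1) = K then a K - 1 else a (i % (K + 1))) (k : ℕ) :
    lexLe (fun t => g (k + t)) g := by
  have hper : (fun t => g (k + t)) = fun t => g (k % (K + 1) + t) := by
    funext t
    rw [hg, hg, Nat.mod_add_mod]
  rw [hper]
  have hj : k % (K + 1) < K + 1 := Nat.mod_lt _ (Nat.succ_pos K)
  generalize k % (K + 1) = j at hj
  have hlt : ∀ i < K, g i = a i := fun i hi => by
    rw [hg, Nat.mod_eq_of_lt (by omega), if_neg (by omega)]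
  have hgK : g K = a K - 1 := by
    rw [hg, Nat.mod_eq_of_lt (by omega), if_pos rfl]
  rcases Nat.eq_zero_or_pos j with rfl | hj0
  · left
    funext t
    rw [zero_add]
  right
  have hjK : j + (K - j) = K := by omega
  rcases (lexLe_iff_prefix (K - j) _ _).1 (ha j) with ⟨d, hd, hpre, hdlt⟩ | ⟨hpre, htail⟩
  · refine ⟨d, fun i hi => ?_, ?_⟩
    · simpa only [hlt (j + i) (by omega), hlt i (by omega)] using hpre i hi
    · simpa only [hlt (j + d) (by omega), hlt d (by omega)] using hdlt
  · refine ⟨K - j, fun i hi => ?_, ?_⟩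
    · simpa only [hlt (j + i) (by omega), hlt i (by omega)] using hpre i hi
    · have hle : a K ≤ a (K - j) := by
        rcases htail with h | ⟨d, hd, h⟩
        · simpa only [add_zero, hjK] using (congrFun h 0).le
        · rcases Nat.eq_zero_or_pos d with rfl | hd0
          · simpa only [add_zero, hjK] using h.le
          · simpa only [add_zero, hjK] using (hd 0 hd0).le
      simp only [hjK, hgK, hlt (K - j) (by omega)]
      omega

theorem genSeq_shift_lexLe {β : ℝ} (hβ : 0 ≤ β) (k : ℕ) :
    lexLe (fun t => genSeq β (k + t)) (genSeq β) := by
  classical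
  by_cases h : ∃ k, betaDigit β 1 k ≠ 0 ∧ ∀ m, k < m → betaDigit β 1 m = 0
  · refine lexLe_shift_of_periodic (Nat.find_spec h).1 (lexLe_betaDigit_one_shift hβ)
      (fun i => ?_) k
    rw [genSeq, dif_pos h]
  · have : genSeq β = betaDigit β 1 := by rw [genSeq, dif_neg h]
    rw [this]
    exact lexLe_betaDigit_one_shift hβ k

/-- If the β-expansion of `1` stops after its first digit, then `β` is that digit. -/
theorem eq_betaDigit_zero_of_forall_pos {β : ℝ} (hβ : 1 < β)
    (h : ∀ m, 0 < m → betaDigit β 1 m = 0) : β = betaDigit β 1 0 := by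
  have hβ0 : 0 ≤ β := by linarith
  have hrem : ∀ m, betaRem β 1 (m + 1) = β ^ m * betaRem β 1 1 := by
    intro m
    induction m with
    | zero => rw [pow_zero, one_mul]
    | succ m ih =>
      rw [betaRem_succ_eq_sub_betaDigit hβ0 zero_le_one, h _ (Nat.succ_pos m), ih, Nat.cast_zero]
      ring
  have hzero : betaRem β 1 1 = 0 := by
    by_contra hne
    have hpos : 0 < betaRem β 1 1 := lt_of_le_of_ne (betaRem_nonneg β zero_le_one 1) (Ne.symm hne)
    obtain ⟨m, hm⟩ := pow_unbounded_of_one_lt (1 / betaRem β 1 1) hβ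
    rw [div_lt_iff₀ hpos, ← hrem m] at hm
    exact absurd hm (not_lt.2 (betaRem_one_le_one β _))
  rw [betaRem_succ_eq_sub_betaDigit hβ0 zero_le_one, betaRem, mul_one] at hzero
  linarith

theorem genSeq_zero_pos {β : ℝ} (hβ : 1 < β) : 0 < genSeq β 0 := by
  classical
  have hpos : 0 < betaDigit β 1 0 := by
    have hfloor : 1 ≤ ⌊β⌋ := Int.le_floor.2 (by exact_mod_cast hβ.le)
    rw [betaDigit, betaRem, mul_one]
    omega
  by_cases h : ∃ k, betaDigit β 1 k ≠ 0 ∧ ∀ m, k < m → betaDigit β 1 m = 0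
  · rw [genSeq, dif_pos h, Nat.zero_mod]
    have hfind := (Nat.find_spec h).2
    generalize Nat.find h = K at hfind
    split_ifs with hK
    · subst hK
      have hlt : (1 : ℝ) < betaDigit β 1 0 :=
        hβ.trans_eq (eq_betaDigit_zero_of_forall_pos hβ hfind)
      exact Nat.sub_pos_of_lt (by exact_mod_cast hlt)
    · exact hpos
  · rw [genSeq, dif_neg h]
    exact hpos

theorem combine_natCast (y x : ℕ → ℕ) (t : ℕ) : combine y x t = x t := by
  simp [combine]

theorem combine_neg_add_of_lt (y x : ℕ → ℕ) {m t : ℕ} (h : t < m) :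
    combine y x (-(m : ℤ) + t) = y (m - 1 - t) := by
  rw [combine, if_neg (by omega)]
  congr 1
  omega

theorem combine_neg_add_add (y x : ℕ → ℕ) (m t : ℕ) :
    combine y x (-(m : ℤ) + (m + t : ℕ)) = x t := by
  rw [← combine_natCast y x t]
  congr 1
  push_cast
  ring

/-- The left ray `⋯ 0 0 w_0 ⋯ w_{i-1}`, read from right to left. -/
def zeroPaddedPrefix (w : ℕ → ℕ) (i : ℕ) : ℕ → ℕ :=
  fun k => if k < i then w (i - 1 - k) else 0

theorem predSet_subset_of_imp {β : ℝ} {x x' : ℕ → ℕ} (hx' : rightRay β x')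
    (h : ∀ m, lexLe x (fun t => genSeq β (m + t)) → lexLe x' (fun t => genSeq β (m + t))) :
    predSet β x ⊆ predSet β x' := by
  intro y hy k
  rcases Int.eq_nat_or_neg k with ⟨m, rfl | rfl⟩
  · have e : (fun t : ℕ => combine y x' ((m : ℤ) + t)) = fun t => x' (m + t) := by
      funext t
      rw [← Nat.cast_add, combine_natCast]
    rw [e]
    exact hx' m
  · have hy' := hy (-(m : ℤ))
    rw [lexLe_iff_prefix m] at hy' ⊢
    rcases hy' with ⟨d, hd, hpre, hlt⟩ | ⟨hpre, htail⟩
    · refine Or.inl ⟨d, hd, fun i hi => ?_, ?_⟩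
      · simpa only [combine_neg_add_of_lt y _ (hi.trans hd)] using hpre i hi
      · simpa only [combine_neg_add_of_lt y _ hd] using hlt
    · refine Or.inr ⟨fun i hi => ?_, ?_⟩
      · simpa only [combine_neg_add_of_lt y _ hi] using hpre i hi
      · simp only [combine_neg_add_add] at htail ⊢
        exact h m htail

theorem rightRay_genSeq_shift {β : ℝ} (hβ : 0 ≤ β) (m : ℕ) :
    rightRay β (fun t => genSeq β (m + t)) := by
  intro k
  simp only [← add_assoc]
  exact genSeq_shift_lexLe hβ (m + k)

theorem zeroPaddedPrefix_mem_predSet {β : ℝ} (hβ : 1 < β) (i : ℕ) :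
    zeroPaddedPrefix (genSeq β) i ∈ predSet β (fun t => genSeq β (i + t)) := by
  have hβ0 : 0 ≤ β := by linarith
  intro k
  rcases Int.eq_nat_or_neg k with ⟨m, rfl | rfl⟩
  · simp only [← Nat.cast_add, combine_natCast]
    exact rightRay_genSeq_shift hβ0 i m
  · by_cases hm : m ≤ i
    · convert genSeq_shift_lexLe hβ0 (i - m) using 2 with t
      by_cases ht : t < m
      · rw [combine_neg_add_of_lt _ _ ht, zeroPaddedPrefix, if_pos (by omega)]
        congr 1
        omega
      · obtain ⟨s, rfl⟩ := Nat.exists_eq_add_of_le (not_lt.1 ht)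
        rw [combine_neg_add_add]
        congr 1
        omega
    · refine Or.inr ⟨0, fun _ h => absurd h (Nat.not_lt_zero _), ?_⟩
      simp only [combine_neg_add_of_lt _ _ (show 0 < m by omega)]
      rw [zeroPaddedPrefix, if_neg (by omega)]
      exact genSeq_zero_pos hβ

theorem lexLe_of_zeroPaddedPrefix_mem_predSet {β : ℝ} {x : ℕ → ℕ} {i : ℕ}
    (h : zeroPaddedPrefix (genSeq β) i ∈ predSet β x) :
    lexLe x (fun t => genSeq β (i + t)) := by
  have hpre : ∀ t < i, combine (zeroPaddedPrefix (genSeq β) i) x (-(i : ℤ) + t) = genSeq β t := by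
    intro t ht
    rw [combine_neg_add_of_lt _ _ ht, zeroPaddedPrefix, if_pos (by omega)]
    congr 1
    omega
  rcases (lexLe_iff_prefix i _ _).1 (h (-(i : ℤ))) with ⟨d, hd, -, hlt⟩ | ⟨-, htail⟩
  · exact absurd hlt (by simp only [hpre d hd, lt_irrefl, not_false_eq_true])
  · simpa only [combine_neg_add_add] using htail

theorem genSeq_shift_eq_of_predSet_eq {β : ℝ} (hβ : 1 < β) {i j : ℕ}
    (h : predSet β (fun t => genSeq β (i + t)) = predSet β (fun t => genSeq β (j + t))) :
    (fun t => genSeq β (i + t)) = fun t => genSeq β (j + t) :=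
  lexLe_antisymm
    (lexLe_of_zeroPaddedPrefix_mem_predSet (h ▸ zeroPaddedPrefix_mem_predSet hβ j))
    (lexLe_of_zeroPaddedPrefix_mem_predSet (h ▸ zeroPaddedPrefix_mem_predSet hβ i))

/-- The shifts of an eventually periodic sequence are among its first `n + p` ones. -/
theorem exists_shift_eq_of_eventually_periodic {g : ℕ → ℕ} {n p : ℕ} (hp : 1 ≤ p)
    (hper : ∀ k, n ≤ k → g (k + p) = g k) (m : ℕ) :
    ∃ i < n + p, ∀ t, g (m + t) = g (i + t) := by
  induction m using Nat.strong_induction_on with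
  | _ m ih =>
    by_cases hm : m < n + p
    · exact ⟨m, hm, fun _ => rfl⟩
    · obtain ⟨i, hi, h⟩ := ih (m - p) (by omega)
      refine ⟨i, hi, fun t => ?_⟩
      rw [← h, ← hper (m - p + t) (by omega)]
      congr 1
      omega

/-- The predecessor set of a right-ray is that of the least shift of `g(β)` above the ray. -/
theorem exists_predSet_eq_genSeq_shift {β : ℝ} (hβ : 0 ≤ β) {n p : ℕ} (hp : 1 ≤ p)
    (hper : ∀ k, n ≤ k → genSeq β (k + p) = genSeq β k) {x : ℕ → ℕ} (hx : rightRay β x) :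
    ∃ i < n + p, predSet β x = predSet β (fun t => genSeq β (i + t)) := by
  classical
  let S := (Finset.range (n + p)).filter fun i => lexLe x (fun t => genSeq β (i + t))
  have hne : S.Nonempty := by
    refine ⟨0, Finset.mem_filter.2 ⟨Finset.mem_range.2 (by omega), ?_⟩⟩
    simpa only [zero_add] using hx 0
  obtain ⟨i, hiS, hmin⟩ := S.exists_min_image (fun i => toLex fun t => genSeq β (i + t)) hne
  obtain ⟨hi, hxi⟩ := Finset.mem_filter.1 hiS
  refine ⟨i, Finset.mem_range.1 hi, Set.Subset.antisymm ?_ ?_⟩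
  · refine predSet_subset_of_imp (rightRay_genSeq_shift hβ i) fun m hm => ?_
    obtain ⟨j, hj, hmj⟩ := exists_shift_eq_of_eventually_periodic hp hper m
    simp only [hmj] at hm ⊢
    exact (lexLe_iff_toLex_le _ _).2
      (hmin j (Finset.mem_filter.2 ⟨Finset.mem_range.2 hj, hm⟩))
  · exact predSet_subset_of_imp hx fun m hm => lexLe_trans hxi hm

/-- Krieger cover equals Fischer cover, cardinality form: if `g(β)` is
eventually periodic with minimal `n ≥ 0`, `p ≥ 1`, then the collection of predecessor sets
of right-rays of `X_β` has exactly `n + p` elements. -/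
theorem statement11 (β : ℝ) (hβ : 1 < β) (n p : ℕ) (hp : 1 ≤ p)
    (hper : ∀ k, n ≤ k → genSeq β (k + p) = genSeq β k)
    (hmin : ∀ n' p' : ℕ, 1 ≤ p' →
      (∀ k, n' ≤ k → genSeq β (k + p') = genSeq β k) → n ≤ n' ∧ p ≤ p') :
    { P : Set (ℕ → ℕ) | ∃ x : ℕ → ℕ, rightRay β x ∧ P = predSet β x }.ncard = n + p := by
  have hβ0 : 0 ≤ β := by linarith
  have himage : { P : Set (ℕ → ℕ) | ∃ x : ℕ → ℕ, rightRay β x ∧ P = predSet β x } =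
      (fun i : ℕ => predSet β (fun t => genSeq β (i + t))) '' (Finset.range (n + p)) := by
    ext P
    constructor
    · rintro ⟨x, hx, rfl⟩
      obtain ⟨i, hi, h⟩ := exists_predSet_eq_genSeq_shift hβ0 hp hper hx
      exact ⟨i, by simpa using hi, h.symm⟩
    · rintro ⟨i, -, rfl⟩
      exact ⟨_, rightRay_genSeq_shift hβ0 i, rfl⟩
  have hlt : ∀ i j, i < j → j < n + p →
      (fun t => genSeq β (i + t)) ≠ fun t => genSeq β (j + t) := by
    intro i j hij hj heq
    have := hmin i (j - i) (by omega) fun k hk => by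
      have e := congrFun heq (k - i)
      have e₁ : i + (k - i) = k := by omega
      have e₂ : j + (k - i) = k + (j - i) := by omega
      simpa only [e₁, e₂] using e.symm
    omega
  rw [himage, Set.InjOn.ncard_image, Set.ncard_coe_finset, Finset.card_range]
  intro i hi j hj hij
  have hi' : i < n + p := by simpa using hi
  have hj' : j < n + p := by simpa using hj
  have heq := genSeq_shift_eq_of_predSet_eq hβ hij
  rcases lt_trichotomy i j with h | h | h
  · exact absurd heq (hlt i j h hj')
  · exact h
  · exact absurd heq.symm (hlt j i h hi')
end
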